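/- Let Z be a metric space with a geodesic bicombing Γ. If Γ is K-coarsely consistent for some K ≥ 0, coarsely (C,D,E)-forward thin, and coarsely (C,D,E)-backward thin for some constants C ≥ 0, D ≥ 0, E ≥ 1, then Γ is geodesic coarsely convex: there exist E' ≥ 1 and C' ≥ 0 such that Γ is an (E',C')-geodesic coarsely convex bicombing on Z. -/

import Mathlib

/-- A geodesic bicombing on a metric space `X`: a map `γ : X × X × [0,1] → X` with
`γ(x,y)(0) = x`, `γ(x,y)(1) = y` and `d(γ(x,y)(t), γ(x,y)(s)) = |t−s|·d(x,y)`. -/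
def IsGeodesicBicombing {X : Type*} [MetricSpace X] (γ : X → X → ℝ → X) : Prop :=
  ∀ x y : X, γ x y 0 = x ∧ γ x y 1 = y ∧
    ∀ t ∈ Set.Icc (0 : ℝ) 1, ∀ s ∈ Set.Icc (0 : ℝ) 1,
      dist (γ x y t) (γ x y s) = |t - s| * dist x y

/-- An `(E,C)`-geodesic coarsely convex bicombing: a geodesic bicombing satisfying the
coarse convexity inequality. -/
def IsGCCBicombing {X : Type*} [MetricSpace X] (E C : ℝ) (γ : X → X → ℝ → X) : Prop :=
  IsGeodesicBicombing γ ∧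
  ∀ (x₁ x₂ y₁ y₂ : X), ∀ a ∈ Set.Icc (0 : ℝ) 1, ∀ b ∈ Set.Icc (0 : ℝ) 1,
    ∀ c ∈ Set.Icc (0 : ℝ) 1,
      dist (γ x₁ y₁ (c * a)) (γ x₂ y₂ (c * b)) ≤
        (1 - c) * E * dist x₁ x₂ + c * E * dist (γ x₁ y₁ a) (γ x₂ y₂ b) + C

/-- A geodesic bicombing `γ` is `K`-coarsely consistent if for all `x, y` and `a ∈ [0,1]`,
setting `z = γ(x,y)(a)`, one has `d(γ(x,z)(c), γ(x,y)(ca)) ≤ K` for all `c ∈ [0,1]`. -/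
def CoarselyConsistent {X : Type*} [MetricSpace X] (K : ℝ) (γ : X → X → ℝ → X) : Prop :=
  ∀ x y : X, ∀ a ∈ Set.Icc (0 : ℝ) 1, ∀ c ∈ Set.Icc (0 : ℝ) 1,
    dist (γ x (γ x y a) c) (γ x y (c * a)) ≤ K

/-- `(E,C)`-coarse forward convexity. -/
def CoarselyForwardConvex {X : Type*} [MetricSpace X] (E C : ℝ) (γ : X → X → ℝ → X) : Prop :=
  ∀ v w₁ w₂ : X, ∀ c ∈ Set.Icc (0 : ℝ) 1,
    dist (γ v w₁ c) (γ v w₂ c) ≤ c * E * dist w₁ w₂ + C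

/-- `(E,C)`-coarse backward convexity. -/
def CoarselyBackwardConvex {X : Type*} [MetricSpace X] (E C : ℝ) (γ : X → X → ℝ → X) : Prop :=
  ∀ v₁ v₂ w : X, ∀ c ∈ Set.Icc (0 : ℝ) 1,
    dist (γ v₁ w c) (γ v₂ w c) ≤ (1 - c) * E * dist v₁ v₂ + C

/-- Two geodesics (parametrized on `[0,1]`) coarsely `D`-fellow travel: endpoints are
`D`-close and the Hausdorff distance between their images is at most `D`. -/
def FellowTravel {Z : Type*} [MetricSpace Z] (D : ℝ) (γ δ : ℝ → Z) : Prop :=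
  dist (γ 0) (δ 0) ≤ D ∧ dist (γ 1) (δ 1) ≤ D ∧
    Metric.hausdorffDist (γ '' Set.Icc (0 : ℝ) 1) (δ '' Set.Icc (0 : ℝ) 1) ≤ D

/-- The subset `X ⊆ Z` is closed under `Γ` and the restriction of `Γ` to `X` satisfies the
`(E,C)`-geodesic coarse convexity inequality. -/
def IsGCCOn {Z : Type*} [MetricSpace Z] (E C : ℝ) (Γ : Z → Z → ℝ → Z) (X : Set Z) : Prop :=
  (∀ p ∈ X, ∀ q ∈ X, ∀ t ∈ Set.Icc (0 : ℝ) 1, Γ p q t ∈ X) ∧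
  ∀ x₁ ∈ X, ∀ x₂ ∈ X, ∀ y₁ ∈ X, ∀ y₂ ∈ X, ∀ a ∈ Set.Icc (0 : ℝ) 1,
    ∀ b ∈ Set.Icc (0 : ℝ) 1, ∀ c ∈ Set.Icc (0 : ℝ) 1,
      dist (Γ x₁ y₁ (c * a)) (Γ x₂ y₂ (c * b)) ≤
        (1 - c) * E * dist x₁ x₂ + c * E * dist (Γ x₁ y₁ a) (Γ x₂ y₂ b) + C

/-- Definition 4.3: `Γ` is coarsely `(C,D,E)`-forward thin. -/
def CoarselyForwardThin {Z : Type*} [MetricSpace Z] (C D E : ℝ)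
    (Γ : Z → Z → ℝ → Z) : Prop :=
  ∀ v w₁ w₂ : Z, 2 * D < min (dist v w₁) (dist v w₂) →
    ∃ (X : Set Z) (c₀ c₁ c₀' c₁' : ℝ),
      IsGCCOn E C Γ X ∧
      0 ≤ c₀ ∧ c₀ ≤ c₁ ∧ c₁ ≤ 1 ∧ 0 ≤ c₀' ∧ c₀' ≤ c₁' ∧ c₁' ≤ 1 ∧
      Γ v w₁ c₀ ∈ X ∧ Γ v w₁ c₁ ∈ X ∧ Γ v w₂ c₀' ∈ X ∧ Γ v w₂ c₁' ∈ X ∧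
      FellowTravel D (fun t => Γ v w₁ (c₀ * t)) (fun t => Γ v w₂ (c₀' * t)) ∧
      dist (Γ v w₁ c₁) (Γ v w₂ c₁') ≤
        max c₁ c₁' * dist (Γ v w₁ 1) (Γ v w₂ 1) + 4 * D ∧
      (∀ u ∈ Set.Icc (0 : ℝ) 1,
        Γ v w₁ (c₀ + u * (c₁ - c₀)) = Γ (Γ v w₁ c₀) (Γ v w₁ c₁) u ∧
        Γ v w₂ (c₀' + u * (c₁' - c₀')) = Γ (Γ v w₂ c₀') (Γ v w₂ c₁') u) ∧
      dist (Γ v w₁ 1) (Γ v w₁ c₁) + dist (Γ v w₁ c₁) (Γ v w₂ c₁') +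
          dist (Γ v w₂ c₁') (Γ v w₂ 1) ≤
        dist (Γ v w₁ 1) (Γ v w₂ 1) + 4 * D

/-- Definition 4.4: `Γ` is coarsely `(C,D,E)`-backward thin. -/
def CoarselyBackwardThin {Z : Type*} [MetricSpace Z] (C D E : ℝ)
    (Γ : Z → Z → ℝ → Z) : Prop :=
  ∀ v₁ v₂ w : Z, 2 * D < min (dist v₁ w) (dist v₂ w) →
    ∃ (X : Set Z) (c₀ c₁ c₀' c₁' : ℝ),
      IsGCCOn E C Γ X ∧
      0 ≤ c₀ ∧ c₀ ≤ c₁ ∧ c₁ ≤ 1 ∧ 0 ≤ c₀' ∧ c₀' ≤ c₁' ∧ c₁' ≤ 1 ∧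
      Γ v₁ w c₀ ∈ X ∧ Γ v₁ w c₁ ∈ X ∧ Γ v₂ w c₀' ∈ X ∧ Γ v₂ w c₁' ∈ X ∧
      FellowTravel D (fun t => Γ v₁ w (c₁ + t * (1 - c₁)))
        (fun t => Γ v₂ w (c₁' + t * (1 - c₁'))) ∧
      dist (Γ v₁ w c₀) (Γ v₂ w c₀') ≤
        max (1 - c₀) (1 - c₀') * dist (Γ v₁ w 0) (Γ v₂ w 0) + 4 * D ∧
      (∀ u ∈ Set.Icc (0 : ℝ) 1,
        Γ v₁ w (c₀ + u * (c₁ - c₀)) = Γ (Γ v₁ w c₀) (Γ v₁ w c₁) u ∧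
        Γ v₂ w (c₀' + u * (c₁' - c₀')) = Γ (Γ v₂ w c₀') (Γ v₂ w c₁') u) ∧
      dist (Γ v₁ w 0) (Γ v₁ w c₀) + dist (Γ v₁ w c₀) (Γ v₂ w c₀') +
          dist (Γ v₂ w c₀') (Γ v₂ w 0) ≤
        dist (Γ v₁ w 0) (Γ v₂ w 0) + 4 * D

/-- A map `g` that has constant speed `L` on `[0,1]`. -/
def HasConstantSpeed {Z : Type*} [MetricSpace Z] (L : ℝ) (g : ℝ → Z) : Prop :=
  ∀ t ∈ Set.Icc (0 : ℝ) 1, ∀ s ∈ Set.Icc (0 : ℝ) 1, dist (g t) (g s) = |t - s| * L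

theorem HasConstantSpeed.comp_one_sub {Z : Type*} [MetricSpace Z] {L : ℝ} {g : ℝ → Z}
    (hg : HasConstantSpeed L g) : HasConstantSpeed L (fun t => g (1 - t)) := by
  intro t ht s hs
  have h := hg (1 - t) ⟨by linarith [ht.2], by linarith [ht.1]⟩
    (1 - s) ⟨by linarith [hs.2], by linarith [hs.1]⟩
  rw [h, show 1 - t - (1 - s) = -(t - s) by ring, abs_neg]

theorem HasConstantSpeed.isBounded_image {Z : Type*} [MetricSpace Z] {L : ℝ} {g : ℝ → Z}
    (hg : HasConstantSpeed L g) (hL : 0 ≤ L) : Bornology.IsBounded (g '' Set.Icc 0 1) := by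
  refine Metric.isBounded_iff.2 ⟨L, ?_⟩
  rintro _ ⟨t, ht, rfl⟩ _ ⟨s, hs, rfl⟩
  rw [hg t ht s hs]
  have : |t - s| ≤ 1 := abs_le.2 ⟨by linarith [ht.1, hs.2], by linarith [ht.2, hs.1]⟩
  nlinarith

theorem FellowTravel.symm {Z : Type*} [MetricSpace Z] {D : ℝ} {γ δ : ℝ → Z}
    (h : FellowTravel D γ δ) : FellowTravel D δ γ := by
  obtain ⟨h₀, h₁, h⟩ := h
  exact ⟨by rwa [dist_comm], by rwa [dist_comm], by rwa [Metric.hausdorffDist_comm]⟩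

/-- If two bounded curves fellow travel, each point of the first is almost `D`-close to the
second. -/
theorem FellowTravel.exists_dist_le {Z : Type*} [MetricSpace Z] {D : ℝ} {γ δ : ℝ → Z}
    (h : FellowTravel D γ δ) (hγ : Bornology.IsBounded (γ '' Set.Icc 0 1))
    (hδ : Bornology.IsBounded (δ '' Set.Icc 0 1)) {ε : ℝ} (hε : 0 < ε)
    {t : ℝ} (ht : t ∈ Set.Icc (0 : ℝ) 1) :
    ∃ s ∈ Set.Icc (0 : ℝ) 1, dist (γ t) (δ s) ≤ D + ε := by
  have hne : (Set.Icc (0 : ℝ) 1).Nonempty := ⟨0, by simp⟩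
  obtain ⟨_, ⟨s, hs, rfl⟩, hlt⟩ := Metric.exists_dist_lt_of_hausdorffDist_lt
    (Set.mem_image_of_mem γ ht) (lt_of_le_of_lt h.2.2 (lt_add_of_pos_right D hε))
    (Metric.hausdorffEDist_ne_top_of_nonempty_of_bounded (hne.image γ) (hne.image δ) hγ hδ)
  exact ⟨s, hs, hlt.le⟩

/-- Two constant speed curves `g₁`, `g₂` issuing from a common point which split into a fellow
travelling part, a coarsely convex part and a part close to a geodesic between the endpoints. -/
structure IsThinPair {Z : Type*} [MetricSpace Z] (C D E L₁ L₂ : ℝ) (g₁ g₂ : ℝ → Z)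
    (c₀ c₁ c₀' c₁' : ℝ) : Prop where
  speed₁ : HasConstantSpeed L₁ g₁
  speed₂ : HasConstantSpeed L₂ g₂
  nonneg₁ : 0 ≤ L₁
  nonneg₂ : 0 ≤ L₂
  start : g₁ 0 = g₂ 0
  c₀_nonneg : 0 ≤ c₀
  c₀_le : c₀ ≤ c₁
  c₁_le : c₁ ≤ 1
  c₀'_nonneg : 0 ≤ c₀'
  c₀'_le : c₀' ≤ c₁'
  c₁'_le : c₁' ≤ 1
  fellow : FellowTravel D (fun t => g₁ (c₀ * t)) (fun t => g₂ (c₀' * t))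
  dist_le : dist (g₁ c₁) (g₂ c₁') ≤ max c₁ c₁' * dist (g₁ 1) (g₂ 1) + 4 * D
  convex : ∀ u ∈ Set.Icc (0 : ℝ) 1,
    dist (g₁ (c₀ + u * (c₁ - c₀))) (g₂ (c₀' + u * (c₁' - c₀'))) ≤
      (1 - u) * E * dist (g₁ c₀) (g₂ c₀') + u * E * dist (g₁ c₁) (g₂ c₁') + C
  sum_le : dist (g₁ 1) (g₁ c₁) + dist (g₁ c₁) (g₂ c₁') + dist (g₂ c₁') (g₂ 1) ≤
    dist (g₁ 1) (g₂ 1) + 4 * D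

namespace IsThinPair

variable {Z : Type*} [MetricSpace Z] {C D E L₁ L₂ : ℝ} {g₁ g₂ : ℝ → Z} {c₀ c₁ c₀' c₁' : ℝ}

theorem symm (h : IsThinPair C D E L₁ L₂ g₁ g₂ c₀ c₁ c₀' c₁') :
    IsThinPair C D E L₂ L₁ g₂ g₁ c₀' c₁' c₀ c₁ where
  speed₁ := h.speed₂
  speed₂ := h.speed₁
  nonneg₁ := h.nonneg₂
  nonneg₂ := h.nonneg₁
  start := h.start.symm
  c₀_nonneg := h.c₀'_nonneg
  c₀_le := h.c₀'_le
  c₁_le := h.c₁'_le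
  c₀'_nonneg := h.c₀_nonneg
  c₀'_le := h.c₀_le
  c₁'_le := h.c₁_le
  fellow := h.fellow.symm
  dist_le := by
    rw [dist_comm, max_comm, dist_comm (g₂ 1)]
    exact h.dist_le
  convex u hu := by
    rw [dist_comm, dist_comm (g₂ c₀'), dist_comm (g₂ c₁')]
    exact h.convex u hu
  sum_le := by
    linarith [h.sum_le, dist_comm (g₂ 1) (g₂ c₁'), dist_comm (g₂ c₁') (g₁ c₁),
      dist_comm (g₁ c₁) (g₁ 1), dist_comm (g₂ 1) (g₁ 1)]

/-- Distances to the common starting point are controlled by mutual distances. -/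
theorem abs_sub_le_dist (h : IsThinPair C D E L₁ L₂ g₁ g₂ c₀ c₁ c₀' c₁') {s t : ℝ}
    (hs : s ∈ Set.Icc (0 : ℝ) 1) (ht : t ∈ Set.Icc (0 : ℝ) 1) :
    |s * L₁ - t * L₂| ≤ dist (g₁ s) (g₂ t) := by
  have h₁ := h.speed₁ s hs 0 (by simp)
  have h₂ := h.speed₂ t ht 0 (by simp)
  rw [sub_zero, abs_of_nonneg hs.1] at h₁
  rw [sub_zero, abs_of_nonneg ht.1, ← h.start] at h₂
  rw [← h₁, ← h₂]
  exact abs_dist_sub_le _ _ _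

/-- Comparing `g₁ c` with `g₂ c` by way of an arbitrary point of `g₂`. -/
theorem dist_le_two_mul_add (h : IsThinPair C D E L₁ L₂ g₁ g₂ c₀ c₁ c₀' c₁') {c t : ℝ}
    (hc : c ∈ Set.Icc (0 : ℝ) 1) (ht : t ∈ Set.Icc (0 : ℝ) 1) :
    dist (g₁ c) (g₂ c) ≤ dist (g₁ c) (g₂ t) + |c * L₁ - t * L₂| + c * dist (g₁ 1) (g₂ 1) := by
  have h₁ := h.abs_sub_le_dist (s := 1) (t := 1) (by simp) (by simp)
  have h₂ : dist (g₂ t) (g₂ c) = |(t - c) * L₂| := by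
    rw [h.speed₂ t ht c hc, abs_mul, abs_of_nonneg h.nonneg₂]
  have h₃ : |(t - c) * L₂| ≤ |c * L₁ - t * L₂| + c * |1 * L₁ - 1 * L₂| := by
    rw [← abs_of_nonneg hc.1, ← abs_mul, abs_of_nonneg hc.1, abs_sub_comm (c * L₁)]
    refine le_trans (le_of_eq ?_) (abs_add_le _ _)
    ring_nf
  have h₄ := mul_le_mul_of_nonneg_left h₁ hc.1
  linarith [dist_triangle (g₁ c) (g₂ t) (g₂ c)]

theorem c₁_mem (h : IsThinPair C D E L₁ L₂ g₁ g₂ c₀ c₁ c₀' c₁') : c₁ ∈ Set.Icc (0 : ℝ) 1 :=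
  ⟨h.c₀_nonneg.trans h.c₀_le, h.c₁_le⟩

theorem c₀_mem (h : IsThinPair C D E L₁ L₂ g₁ g₂ c₀ c₁ c₀' c₁') : c₀ ∈ Set.Icc (0 : ℝ) 1 :=
  ⟨h.c₀_nonneg, h.c₀_le.trans h.c₁_le⟩

theorem isBounded_image_initial (h : IsThinPair C D E L₁ L₂ g₁ g₂ c₀ c₁ c₀' c₁') :
    Bornology.IsBounded ((fun t => g₁ (c₀ * t)) '' Set.Icc 0 1) := by
  refine (h.speed₁.isBounded_image h.nonneg₁).subset ?_
  rintro _ ⟨t, ht, rfl⟩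
  exact ⟨_, unitInterval.mul_mem h.c₀_mem ht, rfl⟩

theorem dist_le_of_le (h : IsThinPair C D E L₁ L₂ g₁ g₂ c₀ c₁ c₀' c₁') {c : ℝ}
    (hc : 0 ≤ c) (hcc : c ≤ c₀) :
    dist (g₁ c) (g₂ c) ≤ c * dist (g₁ 1) (g₂ 1) + 2 * D := by
  have hc' : c ∈ Set.Icc (0 : ℝ) 1 := ⟨hc, hcc.trans h.c₀_mem.2⟩
  obtain ⟨t, ht, rfl⟩ : ∃ t ∈ Set.Icc (0 : ℝ) 1, c₀ * t = c := by
    refine ⟨c / c₀, unitInterval.div_mem hc h.c₀_nonneg hcc, ?_⟩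
    rcases eq_or_ne c₀ 0 with h0 | h0
    · rw [h0, zero_mul]; linarith
    · field_simp
  refine le_of_forall_pos_le_add fun ε hε => ?_
  obtain ⟨s, hs, hst⟩ := h.fellow.exists_dist_le h.isBounded_image_initial
    h.symm.isBounded_image_initial (half_pos hε) ht
  have hs' := unitInterval.mul_mem h.symm.c₀_mem hs
  linarith [h.dist_le_two_mul_add hc' hs', h.abs_sub_le_dist hc' hs']

theorem dist_le_of_mem_middle (h : IsThinPair C D E L₁ L₂ g₁ g₂ c₀ c₁ c₀' c₁') (hD : 0 ≤ D)
    (hE : 0 ≤ E) (hle : c₁' ≤ c₁) {c : ℝ} (hc₀ : c₀ < c) (hc₁ : c ≤ c₁) :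
    dist (g₁ c) (g₂ c) ≤ c * (E + 2) * dist (g₁ 1) (g₂ 1) + (5 * (E + 1) * D + C) := by
  have hpos : 0 < c₁ - c₀ := by linarith
  have hcpos : 0 < c := h.c₀_nonneg.trans_lt hc₀
  have hc : c ∈ Set.Icc (0 : ℝ) 1 := ⟨hcpos.le, hc₁.trans h.c₁_le⟩
  obtain ⟨u, hu, huc⟩ : ∃ u ∈ Set.Icc (0 : ℝ) 1, c₀ + u * (c₁ - c₀) = c :=
    ⟨(c - c₀) / (c₁ - c₀), unitInterval.div_mem (by linarith) hpos.le (by linarith),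
      by field_simp; ring⟩
  have huc₁ : u * c₁ ≤ c := by nlinarith [mul_nonneg (sub_nonneg.2 hu.2) h.c₀_nonneg]
  have ht : c₀' + u * (c₁' - c₀') ∈ Set.Icc (0 : ℝ) 1 := by
    have i₁ := mul_nonneg hu.1 (sub_nonneg.2 h.c₀'_le)
    have i₂ := mul_nonneg (sub_nonneg.2 hu.2) (sub_nonneg.2 h.c₀'_le)
    constructor <;> linarith [h.c₀'_nonneg, h.c₁'_le]
  have h₀ : dist (g₁ c₀) (g₂ c₀') ≤ D := by simpa using h.fellow.2.1
  have hconv := h.convex u hu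
  have hab := h.dist_le
  rw [max_eq_left hle] at hab
  rw [huc] at hconv
  have hradial : |c * L₁ - (c₀' + u * (c₁' - c₀')) * L₂| ≤
      (1 - u) * dist (g₁ c₀) (g₂ c₀') + u * dist (g₁ c₁) (g₂ c₁') := by
    have e₀ := abs_le.1 (h.abs_sub_le_dist h.c₀_mem h.symm.c₀_mem)
    have e₁ := abs_le.1 (h.abs_sub_le_dist h.c₁_mem h.symm.c₁_mem)
    have hu' := sub_nonneg.2 hu.2
    rw [← huc]
    refine abs_le.2 ⟨?_, ?_⟩
    · linarith [mul_le_mul_of_nonneg_left e₀.1 hu', mul_le_mul_of_nonneg_left e₁.1 hu.1]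
    · linarith [mul_le_mul_of_nonneg_left e₀.2 hu', mul_le_mul_of_nonneg_left e₁.2 hu.1]
  have hmain := h.dist_le_two_mul_add hc ht
  have hp : (1 - u) * dist (g₁ c₀) (g₂ c₀') ≤ D := by
    nlinarith [hu.1, hu.2, dist_nonneg (x := g₁ c₀) (y := g₂ c₀')]
  have hq : u * dist (g₁ c₁) (g₂ c₁') ≤ c * dist (g₁ 1) (g₂ 1) + 4 * D := by
    have i₁ := mul_le_mul_of_nonneg_left hab hu.1
    have i₂ := mul_le_mul_of_nonneg_right huc₁ (dist_nonneg (x := g₁ 1) (y := g₂ 1))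
    nlinarith [mul_nonneg (sub_nonneg.2 hu.2) hD]
  linarith [mul_le_mul_of_nonneg_left hp hE, mul_le_mul_of_nonneg_left hq hE]

theorem dist_le_of_ge (h : IsThinPair C D E L₁ L₂ g₁ g₂ c₀ c₁ c₀' c₁') (hD : 0 ≤ D)
    (hle : c₁' ≤ c₁) {c : ℝ} (hc₁ : c₁ ≤ c) (hc : c ≤ 1) :
    dist (g₁ c) (g₂ c) ≤ 3 * c * dist (g₁ 1) (g₂ 1) + 12 * D := by
  have hc0 : 0 ≤ c := h.c₁_mem.1.trans hc₁
  have hone : (1 : ℝ) ∈ Set.Icc (0 : ℝ) 1 := by simp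
  have key : ∀ {L s ℓ : ℝ}, 0 ≤ L → 0 ≤ s → s ≤ c → (1 - s) * L ≤ ℓ + 4 * D →
      (c - s) * L ≤ c * ℓ + 4 * D := by
    intro L s ℓ hL hs hsc hl
    have i₁ := mul_le_mul_of_nonneg_left hl hc0
    have i₂ := mul_nonneg (mul_nonneg hs (sub_nonneg.2 hc)) hL
    have i₃ := mul_nonneg (sub_nonneg.2 hc) hD
    linarith
  have hsum := h.sum_le
  have hab := h.dist_le
  rw [max_eq_left hle] at hab
  have e₁ := h.speed₁ 1 hone c₁ h.c₁_mem
  have e₂ := h.speed₂ c₁' h.symm.c₁_mem 1 hone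
  have f₁ := h.speed₁ c ⟨hc0, hc⟩ c₁ h.c₁_mem
  have f₂ := h.speed₂ c₁' h.symm.c₁_mem c ⟨hc0, hc⟩
  rw [abs_of_nonneg (sub_nonneg.2 h.c₁_le)] at e₁
  rw [abs_sub_comm, abs_of_nonneg (sub_nonneg.2 h.c₁'_le)] at e₂
  rw [abs_of_nonneg (sub_nonneg.2 hc₁)] at f₁
  rw [abs_sub_comm, abs_of_nonneg (sub_nonneg.2 (hle.trans hc₁))] at f₂
  have nab := dist_nonneg (x := g₁ c₁) (y := g₂ c₁')
  have n₁ := dist_nonneg (x := g₁ 1) (y := g₁ c₁)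
  have n₂ := dist_nonneg (x := g₂ c₁') (y := g₂ 1)
  have k₁ := key (ℓ := dist (g₁ 1) (g₂ 1)) h.nonneg₁ h.c₁_mem.1 hc₁ (by linarith)
  have k₂ := key (ℓ := dist (g₁ 1) (g₂ 1)) h.nonneg₂ h.symm.c₁_mem.1 (hle.trans hc₁)
    (by linarith)
  have i := mul_le_mul_of_nonneg_right hc₁ (dist_nonneg (x := g₁ 1) (y := g₂ 1))
  linarith [dist_triangle4 (g₁ c) (g₁ c₁) (g₂ c₁') (g₂ c)]

/-- The curves of a thin pair diverge in a coarsely convex way. -/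
theorem dist_le_mul_add (h : IsThinPair C D E L₁ L₂ g₁ g₂ c₀ c₁ c₀' c₁') (hC : 0 ≤ C)
    (hD : 0 ≤ D) (hE : 1 ≤ E) {c : ℝ} (hc : c ∈ Set.Icc (0 : ℝ) 1) :
    dist (g₁ c) (g₂ c) ≤ c * (E + 2) * dist (g₁ 1) (g₂ 1) + (12 * (E + 1) * D + C) := by
  wlog hle : c₁' ≤ c₁ generalizing L₁ L₂ g₁ g₂ c₀ c₁ c₀' c₁'
  · rw [dist_comm, dist_comm (g₁ 1)]
    exact this h.symm (not_le.1 hle).le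
  have n₁ := mul_nonneg hc.1 (dist_nonneg (x := g₁ 1) (y := g₂ 1))
  have n₂ := mul_nonneg (sub_nonneg.2 hE) n₁
  have n₃ := mul_nonneg (sub_nonneg.2 hE) hD
  rcases le_or_gt c c₀ with h₀ | h₀
  · linarith [h.dist_le_of_le hc.1 h₀]
  rcases le_or_gt c c₁ with h₁ | h₁
  · linarith [h.dist_le_of_mem_middle hD (by linarith) hle h₀ h₁]
  · linarith [h.dist_le_of_ge hD hle h₁.le hc.2]

end IsThinPair

/-- If one of two constant speed curves from a common point is short, they diverge in a coarsely
convex way. -/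
theorem HasConstantSpeed.dist_le_of_min_le {Z : Type*} [MetricSpace Z] {L₁ L₂ D : ℝ}
    {g₁ g₂ : ℝ → Z} (h₁ : HasConstantSpeed L₁ g₁) (h₂ : HasConstantSpeed L₂ g₂)
    (h0 : g₁ 0 = g₂ 0) (hD : 0 ≤ D) (hmin : min L₁ L₂ ≤ 2 * D) {c : ℝ}
    (hc : c ∈ Set.Icc (0 : ℝ) 1) :
    dist (g₁ c) (g₂ c) ≤ c * dist (g₁ 1) (g₂ 1) + 4 * D := by
  wlog hle : L₁ ≤ L₂ generalizing L₁ L₂ g₁ g₂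
  · rw [dist_comm, dist_comm (g₁ 1)]
    exact this h₂ h₁ h0.symm (by rwa [min_comm]) (not_le.1 hle).le
  rw [min_eq_left hle] at hmin
  have e₁ := h₁ c hc 0 (by simp)
  have e₂ := h₂ 0 (by simp) c hc
  have f₁ := h₁ 0 (by simp) 1 (by simp)
  have f₂ := h₂ 0 (by simp) 1 (by simp)
  norm_num [abs_of_nonneg hc.1] at e₁ e₂ f₁ f₂
  rw [← h0] at e₂ f₂
  have t₁ := mul_le_mul_of_nonneg_left (dist_triangle (g₁ 0) (g₁ 1) (g₂ 1)) hc.1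
  have t₂ := mul_le_mul_of_nonneg_left hmin hc.1
  rw [f₁, f₂] at t₁
  nlinarith [dist_triangle (g₁ c) (g₁ 0) (g₂ c), mul_nonneg (sub_nonneg.2 hc.2) hD]

section Thin

variable {Z : Type*} [MetricSpace Z] {Γ : Z → Z → ℝ → Z} {C D E : ℝ}

theorem IsGeodesicBicombing.hasConstantSpeed (hΓ : IsGeodesicBicombing Γ) (x y : Z) :
    HasConstantSpeed (dist x y) (Γ x y) :=
  (hΓ x y).2.2

theorem IsGCCOn.dist_le (hΓ : IsGeodesicBicombing Γ) {X : Set Z} (hX : IsGCCOn E C Γ X)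
    {p₁ p₂ q₁ q₂ : Z} (hp₁ : p₁ ∈ X) (hp₂ : p₂ ∈ X) (hq₁ : q₁ ∈ X) (hq₂ : q₂ ∈ X) {u : ℝ}
    (hu : u ∈ Set.Icc (0 : ℝ) 1) :
    dist (Γ p₁ q₁ u) (Γ p₂ q₂ u) ≤ (1 - u) * E * dist p₁ p₂ + u * E * dist q₁ q₂ + C := by
  have h := hX.2 p₁ hp₁ p₂ hp₂ q₁ hq₁ q₂ hq₂ 1 (by simp) 1 (by simp) u hu
  rwa [mul_one, (hΓ p₁ q₁).2.1, (hΓ p₂ q₂).2.1] at h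

theorem CoarselyForwardThin.coarselyForwardConvex (hΓ : IsGeodesicBicombing Γ)
    (h : CoarselyForwardThin C D E Γ) (hC : 0 ≤ C) (hD : 0 ≤ D) (hE : 1 ≤ E) :
    CoarselyForwardConvex (E + 2) (12 * (E + 1) * D + C) Γ := by
  intro v w₁ w₂ c hc
  have hstart : Γ v w₁ 0 = Γ v w₂ 0 := by rw [(hΓ v w₁).1, (hΓ v w₂).1]
  have hend : dist (Γ v w₁ 1) (Γ v w₂ 1) = dist w₁ w₂ := by rw [(hΓ v w₁).2.1, (hΓ v w₂).2.1]
  rw [← hend]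
  rcases le_or_gt (min (dist v w₁) (dist v w₂)) (2 * D) with hmin | hmin
  · have h' := (hΓ.hasConstantSpeed v w₁).dist_le_of_min_le (hΓ.hasConstantSpeed v w₂) hstart hD
      hmin hc
    have n₁ := mul_nonneg hc.1 (dist_nonneg (x := Γ v w₁ 1) (y := Γ v w₂ 1))
    have n₂ := mul_nonneg (sub_nonneg.2 hE) n₁
    have n₃ := mul_nonneg (sub_nonneg.2 hE) hD
    linarith
  obtain ⟨X, c₀, c₁, c₀', c₁', hX, h0, h01, h1, h0', h01', h1', m₀, m₁, m₀', m₁', hft, hd, hmid,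
    hsum⟩ := h v w₁ w₂ hmin
  have hpair : IsThinPair C D E (dist v w₁) (dist v w₂) (Γ v w₁) (Γ v w₂) c₀ c₁ c₀' c₁' :=
    { speed₁ := hΓ.hasConstantSpeed _ _
      speed₂ := hΓ.hasConstantSpeed _ _
      nonneg₁ := dist_nonneg
      nonneg₂ := dist_nonneg
      start := hstart
      c₀_nonneg := h0
      c₀_le := h01
      c₁_le := h1
      c₀'_nonneg := h0'
      c₀'_le := h01'
      c₁'_le := h1'
      fellow := hft
      dist_le := hd
      convex := fun u hu => by
        rw [(hmid u hu).1, (hmid u hu).2]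
        exact hX.dist_le hΓ m₀ m₀' m₁ m₁' hu
      sum_le := hsum }
  exact hpair.dist_le_mul_add hC hD hE hc

theorem FellowTravel.comp_one_sub {γ δ : ℝ → Z} (h : FellowTravel D γ δ) :
    FellowTravel D (fun t => γ (1 - t)) (fun t => δ (1 - t)) := by
  have himage : ∀ f : ℝ → Z,
      (fun t => f (1 - t)) '' Set.Icc (0 : ℝ) 1 = f '' Set.Icc (0 : ℝ) 1 := by
    intro f
    rw [← Set.image_image f (fun t => 1 - t), Set.image_const_sub_Icc]
    norm_num
  refine ⟨?_, ?_, ?_⟩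
  · simpa using h.2.1
  · simpa using h.1
  · rw [himage, himage]
    exact h.2.2

theorem CoarselyBackwardThin.coarselyBackwardConvex (hΓ : IsGeodesicBicombing Γ)
    (h : CoarselyBackwardThin C D E Γ) (hC : 0 ≤ C) (hD : 0 ≤ D) (hE : 1 ≤ E) :
    CoarselyBackwardConvex (E + 2) (12 * (E + 1) * D + C) Γ := by
  intro v₁ v₂ w c hc
  have hc' : 1 - c ∈ Set.Icc (0 : ℝ) 1 := ⟨by linarith [hc.2], by linarith [hc.1]⟩
  set g₁ : ℝ → Z := fun t => Γ v₁ w (1 - t) with hg₁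
  set g₂ : ℝ → Z := fun t => Γ v₂ w (1 - t) with hg₂
  have s₁ : HasConstantSpeed (dist v₁ w) g₁ := (hΓ.hasConstantSpeed v₁ w).comp_one_sub
  have s₂ : HasConstantSpeed (dist v₂ w) g₂ := (hΓ.hasConstantSpeed v₂ w).comp_one_sub
  have hstart : g₁ 0 = g₂ 0 := by simp [hg₁, hg₂, (hΓ v₁ w).2.1, (hΓ v₂ w).2.1]
  have hend : dist (g₁ 1) (g₂ 1) = dist v₁ v₂ := by
    simp [hg₁, hg₂, (hΓ v₁ w).1, (hΓ v₂ w).1]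
  have hval : dist (g₁ (1 - c)) (g₂ (1 - c)) = dist (Γ v₁ w c) (Γ v₂ w c) := by simp [hg₁, hg₂]
  rw [← hend, ← hval]
  rcases le_or_gt (min (dist v₁ w) (dist v₂ w)) (2 * D) with hmin | hmin
  · have h' := s₁.dist_le_of_min_le s₂ hstart hD hmin hc'
    have n₁ := mul_nonneg hc'.1 (dist_nonneg (x := g₁ 1) (y := g₂ 1))
    have n₂ := mul_nonneg (sub_nonneg.2 hE) n₁
    have n₃ := mul_nonneg (sub_nonneg.2 hE) hD
    linarith
  obtain ⟨X, c₀, c₁, c₀', c₁', hX, h0, h01, h1, h0', h01', h1', m₀, m₁, m₀', m₁', hft, hd, hmid,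
    hsum⟩ := h v₁ v₂ w hmin
  have hpair : IsThinPair C D E (dist v₁ w) (dist v₂ w) g₁ g₂
      (1 - c₁) (1 - c₀) (1 - c₁') (1 - c₀') :=
    { speed₁ := s₁
      speed₂ := s₂
      nonneg₁ := dist_nonneg
      nonneg₂ := dist_nonneg
      start := hstart
      c₀_nonneg := by linarith
      c₀_le := by linarith
      c₁_le := by linarith
      c₀'_nonneg := by linarith
      c₀'_le := by linarith
      c₁'_le := by linarith
      fellow := by
        convert hft.comp_one_sub using 3 <;> ring
      dist_le := by simpa [hg₁, hg₂] using hd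
      convex := fun u hu => by
        have hu' : 1 - u ∈ Set.Icc (0 : ℝ) 1 := ⟨by linarith [hu.2], by linarith [hu.1]⟩
        have hconv := hX.dist_le hΓ m₀ m₀' m₁ m₁' hu'
        rw [← (hmid _ hu').1, ← (hmid _ hu').2] at hconv
        have e₁ : 1 - (1 - c₁ + u * (1 - c₀ - (1 - c₁))) = c₀ + (1 - u) * (c₁ - c₀) := by ring
        have e₂ : 1 - (1 - c₁' + u * (1 - c₀' - (1 - c₁'))) =
            c₀' + (1 - u) * (c₁' - c₀') := by ring
        simp only [hg₁, hg₂, e₁, e₂, sub_sub_cancel] at hconv ⊢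
        linarith
      sum_le := by simpa [hg₁, hg₂] using hsum }
  exact hpair.dist_le_mul_add hC hD hE hc'

/-- Coarse forward and backward convexity together with coarse consistency give coarse
convexity. -/
theorem CoarselyConsistent.isGCCBicombing {K : ℝ} (hΓ : IsGeodesicBicombing Γ)
    (hcon : CoarselyConsistent K Γ) (hf : CoarselyForwardConvex E C Γ)
    (hb : CoarselyBackwardConvex E C Γ) : IsGCCBicombing E (2 * K + 2 * C) Γ := by
  refine ⟨hΓ, fun x₁ x₂ y₁ y₂ a ha b hb' c hc => ?_⟩
  have h₁ := hcon x₁ y₁ a ha c hc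
  have h₂ := hcon x₂ y₂ b hb' c hc
  have h₃ := hf x₁ (Γ x₁ y₁ a) (Γ x₂ y₂ b) c hc
  have h₄ := hb x₁ x₂ (Γ x₂ y₂ b) c hc
  rw [dist_comm] at h₁
  linarith [dist_triangle4 (Γ x₁ y₁ (c * a)) (Γ x₁ (Γ x₁ y₁ a) c) (Γ x₂ (Γ x₂ y₂ b) c)
      (Γ x₂ y₂ (c * b)),
    dist_triangle (Γ x₁ (Γ x₁ y₁ a) c) (Γ x₁ (Γ x₂ y₂ b) c) (Γ x₂ (Γ x₂ y₂ b) c)]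

end Thin

/-- Theorem 4.5: a geodesic bicombing which is `K`-coarsely consistent, coarsely
`(C,D,E)`-forward thin and coarsely `(C,D,E)`-backward thin is geodesic coarsely convex:
it is an `(E',C')`-geodesic coarsely convex bicombing for some `E' ≥ 1` and `C' ≥ 0`. -/
theorem isGCCBicombing_of_consistent_and_thin {Z : Type*} [MetricSpace Z]
    (Γ : Z → Z → ℝ → Z) (hΓ : IsGeodesicBicombing Γ)
    (K C D E : ℝ) (hK : 0 ≤ K) (hC : 0 ≤ C) (hD : 0 ≤ D) (hE : 1 ≤ E)
    (hcon : CoarselyConsistent K Γ)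
    (hfwd : CoarselyForwardThin C D E Γ)
    (hbwd : CoarselyBackwardThin C D E Γ) :
    ∃ E' C' : ℝ, 1 ≤ E' ∧ 0 ≤ C' ∧ IsGCCBicombing E' C' Γ := by
  refine ⟨E + 2, 2 * K + 2 * (12 * (E + 1) * D + C), by linarith, by positivity, ?_⟩
  exact hcon.isGCCBicombing hΓ (hfwd.coarselyForwardConvex hΓ hC hD hE)
    (hbwd.coarselyBackwardConvex hΓ hC hD hE)
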